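/- arXiv:1503.03879 — 4 statements merged into one kernel-verified Lean document; each statement's English description precedes it below -/
import Mathlib

section
/- Let Σ be a symmetric positive definite real matrix indexed by V×V. Let a, c, c' ∈ V be distinct and let Z ⊆ V \ {a, c, c'}. If σ_{ac'|{c}∪Z} = 0 (i.e., a ⟂⟂ c' | {c} ∪ Z for the Gaussian vector with covariance Σ), then ρ²_{ac'|Z} ≤ ρ²_{ac|Z}. -/
open Matrix

variable {V : Type*}

/-- Partial covariance `σ_{uv|Z} = Σ_{uv} − Σ_{uZ} (Σ_{ZZ})⁻¹ Σ_{Zv}`. -/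
noncomputable def pcov [Fintype V] [DecidableEq V] (S : Matrix V V ℝ) (u v : V) (Z : Finset V) : ℝ :=
  S u v - ∑ i : {x // x ∈ Z}, ∑ j : {x // x ∈ Z},
    S u (i : V) * (Matrix.of (fun i j : {x // x ∈ Z} => S (i : V) (j : V)))⁻¹ i j * S (j : V) v

/-- Squared partial correlation `ρ²_{uv|Z}`. -/
noncomputable def rho2 [Fintype V] [DecidableEq V] (S : Matrix V V ℝ) (u v : V) (Z : Finset V) : ℝ :=
  pcov S u v Z ^ 2 / (pcov S u u Z * pcov S v v Z)

/-- `r` is the coefficient vector of the residual of `v` after regression on `Z`. -/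
def IsResidual [Fintype V] [DecidableEq V] (S : Matrix V V ℝ) (v : V) (Z : Finset V)
    (r : V → ℝ) : Prop :=
  (∀ i ∈ Z, (S *ᵥ r) i = 0) ∧ ∀ i ∉ Z, r i = (Pi.single v 1 : V → ℝ) i

theorem mulVec_eq_sum_subtype [Fintype V] [DecidableEq V] (S : Matrix V V ℝ) (Z : Finset V)
    {f : V → ℝ} (hf : ∀ i ∉ Z, f i = 0) (u : V) :
    (S *ᵥ f) u = ∑ i : {x // x ∈ Z}, S u i * f i := by
  rw [Finset.sum_coe_sort Z (fun i => S u i * f i), Matrix.mulVec, dotProduct]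
  exact (Finset.sum_subset (Finset.subset_univ Z) fun i _ hi => by simp [hf i hi]).symm

theorem isUnit_det_principal [Fintype V] [DecidableEq V] {S : Matrix V V ℝ} (hpd : S.PosDef)
    (Z : Finset V) :
    IsUnit (Matrix.of (fun i j : {x // x ∈ Z} => S (i : V) (j : V))).det :=
  (hpd.submatrix (e := ((↑) : {x // x ∈ Z} → V)) Subtype.val_injective).det_pos.ne'.isUnit

theorem exists_isResidual [Fintype V] [DecidableEq V] {S : Matrix V V ℝ} (hpd : S.PosDef)
    (v : V) (Z : Finset V) : ∃ r, IsResidual S v Z r := by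
  set M := Matrix.of (fun i j : {x // x ∈ Z} => S (i : V) (j : V)) with hM
  let w : {x // x ∈ Z} → ℝ := M⁻¹ *ᵥ fun i : {x // x ∈ Z} => S i v
  let f : V → ℝ := fun i => if h : i ∈ Z then w ⟨i, h⟩ else 0
  have hf : ∀ i ∉ Z, f i = 0 := fun i hi => dif_neg hi
  refine ⟨Pi.single v 1 - f, fun i hi => ?_, fun i hi => by simp [hf i hi]⟩
  have hw : M *ᵥ w = fun i : {x // x ∈ Z} => S i v := by
    rw [Matrix.mulVec_mulVec, Matrix.mul_nonsing_inv _ (isUnit_det_principal hpd Z),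
      Matrix.one_mulVec]
  have hfi : (S *ᵥ f) i = S i v := by
    rw [mulVec_eq_sum_subtype S Z hf, ← congrFun hw ⟨i, hi⟩]
    simp [Matrix.mulVec, dotProduct, f, hM]
  simp [Matrix.mulVec_sub, hfi]

theorem IsResidual.pcov_eq [Fintype V] [DecidableEq V] {S : Matrix V V ℝ} (hpd : S.PosDef)
    {v : V} {Z : Finset V} {r : V → ℝ} (hr : IsResidual S v Z r) (u : V) :
    pcov S u v Z = (S *ᵥ r) u := by
  set M := Matrix.of (fun i j : {x // x ∈ Z} => S (i : V) (j : V)) with hM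
  let f : V → ℝ := Pi.single v 1 - r
  have hf : ∀ i ∉ Z, f i = 0 := fun i hi => by simp [f, hr.2 i hi]
  have hSf : ∀ i, (S *ᵥ f) i = S i v - (S *ᵥ r) i := fun i => by simp [f, Matrix.mulVec_sub]
  have hw : M *ᵥ (fun i : {x // x ∈ Z} => f i) = fun i : {x // x ∈ Z} => S i v := by
    ext i
    rw [← sub_zero (S i v), ← hr.1 i i.2, ← hSf, mulVec_eq_sum_subtype S Z hf]
    rfl
  have hinv : M⁻¹ *ᵥ (fun i : {x // x ∈ Z} => S i v) = fun i : {x // x ∈ Z} => f i := by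
    rw [← hw, Matrix.mulVec_mulVec, Matrix.nonsing_inv_mul _ (isUnit_det_principal hpd Z),
      Matrix.one_mulVec]
  have hsum : (S *ᵥ f) u = ∑ i : {x // x ∈ Z}, ∑ j : {x // x ∈ Z},
      S u i * M⁻¹ i j * S j v := by
    rw [mulVec_eq_sum_subtype S Z hf]
    refine Finset.sum_congr rfl fun i _ => ?_
    rw [← congrFun hinv i, Matrix.mulVec, dotProduct, Finset.mul_sum]
    exact Finset.sum_congr rfl fun j _ => (mul_assoc _ _ _).symm
  rw [pcov, ← hM, ← hsum, hSf, sub_sub_cancel]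

theorem IsResidual.dotProduct_mulVec [Fintype V] [DecidableEq V] {S : Matrix V V ℝ}
    {u v : V} {Z : Finset V} {p r : V → ℝ} (hp : IsResidual S u Z p)
    (hr : IsResidual S v Z r) : p ⬝ᵥ S *ᵥ r = (S *ᵥ r) u := by
  rw [← single_one_dotProduct u (S *ᵥ r)]
  refine Finset.sum_congr rfl fun i _ => ?_
  by_cases hi : i ∈ Z
  · simp [hr.1 i hi]
  · rw [hp.2 i hi]

theorem pcov_self_pos [Fintype V] [DecidableEq V] {S : Matrix V V ℝ} (hpd : S.PosDef)
    {v : V} {Z : Finset V} (hv : v ∉ Z) : 0 < pcov S v v Z := by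
  obtain ⟨r, hr⟩ := exists_isResidual hpd v Z
  rw [hr.pcov_eq hpd, ← hr.dotProduct_mulVec hr]
  have hne : r ≠ 0 := fun h0 => by simpa [h0] using hr.2 v hv
  simpa using hpd.dotProduct_mulVec_pos hne

theorem pcov_comm [Fintype V] [DecidableEq V] {S : Matrix V V ℝ} (hsym : S.IsSymm)
    (hpd : S.PosDef) (u v : V) (Z : Finset V) :
    pcov S u v Z = pcov S v u Z := by
  obtain ⟨p, hp⟩ := exists_isResidual hpd u Z
  obtain ⟨r, hr⟩ := exists_isResidual hpd v Z
  rw [hr.pcov_eq hpd, hp.pcov_eq hpd, ← hp.dotProduct_mulVec hr, ← hr.dotProduct_mulVec hp,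
    Matrix.dotProduct_mulVec, ← Matrix.mulVec_transpose, hsym.eq, dotProduct_comm]

theorem pcov_insert [Fintype V] [DecidableEq V] {S : Matrix V V ℝ} (hpd : S.PosDef)
    (u v : V) {c : V} {Z : Finset V} (hc : c ∉ Z) :
    pcov S u v (insert c Z) =
      pcov S u v Z - pcov S c v Z / pcov S c c Z * pcov S u c Z := by
  have hpos := pcov_self_pos hpd hc
  obtain ⟨p, hp⟩ := exists_isResidual hpd c Z
  obtain ⟨r, hr⟩ := exists_isResidual hpd v Z
  simp only [hr.pcov_eq hpd, hp.pcov_eq hpd] at hpos ⊢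
  set t := (S *ᵥ r) c / (S *ᵥ p) c with ht
  have hS : ∀ i, (S *ᵥ (r - t • p)) i = (S *ᵥ r) i - t * (S *ᵥ p) i := fun i => by
    simp [Matrix.mulVec_sub, Matrix.mulVec_smul]
  have hres : IsResidual S v (insert c Z) (r - t • p) := by
    refine ⟨fun i hi => ?_, fun i hi => ?_⟩
    · rw [hS]
      rcases Finset.mem_insert.1 hi with rfl | hi
      · rw [ht, div_mul_cancel₀ _ hpos.ne', sub_self]
      · rw [hr.1 i hi, hp.1 i hi, mul_zero, sub_zero]
    · rw [Finset.mem_insert, not_or] at hi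
      simp [hr.2 i hi.2, hp.2 i hi.2, hi.1]
  rw [hres.pcov_eq hpd, hS]

/-- if `a ⟂⟂ c' | {c} ∪ Z` then `ρ²_{ac'|Z} ≤ ρ²_{ac|Z}`. -/
theorem stmt_0 [Fintype V] [DecidableEq V] [Nonempty V]
    (S : Matrix V V ℝ) (hsym : S.IsSymm) (hpd : S.PosDef)
    (a c c' : V) (hac : a ≠ c) (hac' : a ≠ c') (hcc' : c ≠ c')
    (Z : Finset V) (haZ : a ∉ Z) (hcZ : c ∉ Z) (hc'Z : c' ∉ Z)
    (h : pcov S a c' (insert c Z) = 0) :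
    rho2 S a c' Z ≤ rho2 S a c Z := by
  have ha := pcov_self_pos hpd haZ
  have hc := pcov_self_pos hpd hcZ
  have hc' := pcov_self_pos hpd hc'Z
  have hpos : 0 < pcov S c' c' (insert c Z) :=
    pcov_self_pos hpd (by simp [hcc'.symm, hc'Z])
  rw [pcov_insert hpd _ _ hcZ, pcov_comm hsym hpd c' c, sub_pos, div_mul_eq_mul_div,
    div_lt_iff₀ hc] at hpos
  rw [pcov_insert hpd _ _ hcZ, sub_eq_zero, div_mul_eq_mul_div, eq_div_iff hc.ne'] at h
  rw [rho2, rho2, div_le_div_iff₀ (mul_pos ha hc') (mul_pos ha hc)]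
  refine le_of_mul_le_mul_right ?_ hc
  calc pcov S a c' Z ^ 2 * (pcov S a a Z * pcov S c c Z) * pcov S c c Z
      = pcov S a a Z * (pcov S a c' Z * pcov S c c Z) ^ 2 := by ring
    _ = pcov S a c Z ^ 2 * pcov S a a Z * (pcov S c c' Z * pcov S c c' Z) := by rw [h]; ring
    _ ≤ pcov S a c Z ^ 2 * pcov S a a Z * (pcov S c' c' Z * pcov S c c Z) := by gcongr
    _ = pcov S a c Z ^ 2 * (pcov S a a Z * pcov S c' c' Z) * pcov S c c Z := by ring
end

section
/- Let Σ be a symmetric positive definite real matrix indexed by V×V and let a, c, z ∈ V be distinct. Suppose there exists x ∈ V \ {z} such that σ_{ac|{x}} = 0, σ_{az|{x}} = 0 and σ_{cz|{x}} = 0. Then ρ²_{ac|{z}} ≤ ρ²_{ac}. -/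
open Matrix

variable {V : Type*}

theorem pcov_empty [Fintype V] [DecidableEq V] (S : Matrix V V ℝ) (u v : V) :
    pcov S u v ∅ = S u v := by
  simp [pcov]

theorem pcov_singleton [Fintype V] [DecidableEq V] (S : Matrix V V ℝ) (u v w : V) :
    pcov S u v {w} = S u v - S u w * (S w w)⁻¹ * S w v := by
  have : Unique {x // x ∈ ({w} : Finset V)} :=
    ⟨⟨⟨w, Finset.mem_singleton_self w⟩⟩, fun y => Subtype.ext (Finset.mem_singleton.mp y.2)⟩
  have hd : ((default : {x // x ∈ ({w} : Finset V)}) : V) = w :=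
    Finset.mem_singleton.mp (default : {x // x ∈ ({w} : Finset V)}).2
  simp [pcov, Matrix.inv_subsingleton, hd]

/-- Cauchy–Schwarz for the entries of a positive semidefinite real matrix. -/
theorem Matrix.PosSemidef.sq_apply_le {S : Matrix V V ℝ} (hS : S.PosSemidef) (u v : V) :
    S u v ^ 2 ≤ S u u * S v v := by
  have h := (hS.submatrix ![u, v]).det_nonneg
  have hs : S v u = S u v := by simpa using hS.isHermitian.apply u v
  rw [Matrix.det_fin_two] at h
  simp [hs] at h
  linarith [sq (S u v)]

/-- Passing from `m ^ 2 / (A * C)` to a version whose numerator shrinks by `(1 - t) ^ 2` and whose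
denominator shrinks by at most that factor. -/
theorem sq_mul_div_le_sq_div {A C D E m t : ℝ} (hA : 0 < A) (hC : 0 < C) (ht : t ≤ 1)
    (hD : A * (1 - t) ≤ D) (hE : C * (1 - t) ≤ E) :
    (m * (1 - t)) ^ 2 / (D * E) ≤ m ^ 2 / (A * C) := by
  rcases ht.eq_or_lt with rfl | ht
  · simp only [sub_self, mul_zero, ne_eq, OfNat.ofNat_ne_zero, not_false_eq_true, zero_pow,
      zero_div]
    positivity
  have h1 : 0 < 1 - t := by linarith
  have hAt : 0 < A * (1 - t) := by positivity
  have hCt : 0 < C * (1 - t) := by positivity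
  have hD0 : 0 ≤ D := hAt.le.trans hD
  calc (m * (1 - t)) ^ 2 / (D * E)
      ≤ (m * (1 - t)) ^ 2 / ((A * (1 - t)) * (C * (1 - t))) := by gcongr
    _ = m ^ 2 / (A * C) := by field_simp

/-- Theorem 2, part 1: if for some `x ≠ z` we have
`a ⟂⟂ c | x`, `a ⟂⟂ z | x` and `c ⟂⟂ z | x`, then `ρ²_{ac|z} ≤ ρ²_{ac}`. -/
theorem stmt_1 [Fintype V] [DecidableEq V] [Nonempty V]
    (S : Matrix V V ℝ) (hsym : S.IsSymm) (hpd : S.PosDef)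
    (a c z : V) (hac : a ≠ c) (haz : a ≠ z) (hcz : c ≠ z)
    (h : ∃ x : V, x ≠ z ∧ pcov S a c {x} = 0 ∧ pcov S a z {x} = 0 ∧ pcov S c z {x} = 0) :
    rho2 S a c {z} ≤ rho2 S a c ∅ := by
  obtain ⟨x, -, h1, h2, h3⟩ := h
  have hX : 0 < S x x := hpd.diag_pos
  have hZ : 0 < S z z := hpd.diag_pos
  have hxc : S x c = S c x := hsym.apply c x
  have hxz : S x z = S z x := hsym.apply z x
  rw [pcov_singleton, sub_eq_zero] at h1 h2 h3
  rw [hxc] at h1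
  rw [hxz] at h2 h3
  set t : ℝ := S z x ^ 2 * (S x x)⁻¹ * (S z z)⁻¹ with ht
  have ht0 : 0 ≤ t := by positivity
  have ht1 : t ≤ 1 := by
    have := hpd.posSemidef.sq_apply_le z x
    rw [ht, ← div_eq_mul_inv, ← div_eq_mul_inv, div_div, div_le_one (by positivity)]
    linarith
  have key : ∀ u, S u z = S u x * (S x x)⁻¹ * S z x → S u u * (1 - t) ≤ pcov S u u {z} := by
    intro u hu
    have hle : S u x ^ 2 * (S x x)⁻¹ ≤ S u u := by
      rw [← div_eq_mul_inv, div_le_iff₀ hX]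
      exact hpd.posSemidef.sq_apply_le u x
    have heq : pcov S u u {z} = S u u - S u x ^ 2 * (S x x)⁻¹ * t := by
      rw [pcov_singleton, hsym.apply u z, hu, ht]
      ring
    rw [heq]
    nlinarith [mul_le_mul_of_nonneg_right hle ht0]
  have hnum : pcov S a c {z} = S a c * (1 - t) := by
    rw [pcov_singleton, hsym.apply c z, h1, h2, h3, ht]
    ring
  unfold rho2
  rw [hnum]
  simp only [pcov_empty]
  exact sq_mul_div_le_sq_div hpd.diag_pos hpd.diag_pos ht1 (key a h2) (key c h3)
end

section
/- Let Σ be a symmetric positive definite real matrix indexed by V×V and let a, c, z, z' ∈ V be distinct. Suppose there exists x ∈ V \ {z} such that σ_{ac|{x}} = 0, σ_{az|{x}} = 0 and σ_{cz|{x}} = 0, and suppose moreover that σ_{az'|{z}} = 0 and σ_{cz'|{z}} = 0. Then ρ²_{ac|{z}} ≤ ρ²_{ac|{z'}} ≤ ρ²_{ac}. -/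
open Matrix

variable {V : Type*}

theorem sq_lt_mul_diag_of_posDef [Fintype V] {S : Matrix V V ℝ} (hsym : S.IsSymm)
    (hpd : S.PosDef) {u v : V} (huv : u ≠ v) : S u v ^ 2 < S u u * S v v := by
  have hinj : Function.Injective ![u, v] := by
    intro i j hij
    fin_cases i <;> fin_cases j <;> simp_all
  have hdet := (hpd.submatrix hinj).det_pos
  rw [Matrix.det_fin_two] at hdet
  simp only [Matrix.submatrix_apply, Matrix.cons_val_zero, Matrix.cons_val_one] at hdet
  rw [hsym.apply u v] at hdet
  linarith

theorem sq_le_mul_diag_of_posDef [Fintype V] {S : Matrix V V ℝ} (hsym : S.IsSymm)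
    (hpd : S.PosDef) (u v : V) : S u v ^ 2 ≤ S u u * S v v := by
  rcases eq_or_ne u v with rfl | huv
  · exact (sq (S u u)).le
  · exact (sq_lt_mul_diag_of_posDef hsym hpd huv).le

theorem one_sub_div_sub_mul_anti {A e s t : ℝ} (he : e ≤ A) (hst : s ≤ t)
    (hs : 0 < A - s * e) (ht : 0 < A - t * e) :
    (1 - t) / (A - t * e) ≤ (1 - s) / (A - s * e) := by
  rw [div_le_div_iff₀ ht hs]
  nlinarith [mul_nonneg (sub_nonneg.2 hst) (sub_nonneg.2 he)]

/-- If the covariances of three variables factor through a fourth variable of variance `X`, the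
squared correlation of the first two decreases in the multiple `k` of the third one's
contribution that is removed. -/
theorem sq_div_mul_anti_of_factor {A C X Z α γ ζ k l : ℝ} (hX : 0 < X) (hZ : 0 < Z)
    (hA : 0 < A) (hC : 0 < C)
    (hα : α ^ 2 ≤ A * X) (hγ : γ ^ 2 ≤ C * X) (hζ : ζ ^ 2 ≤ X * Z)
    (hαζ : (α * ζ / X) ^ 2 < A * Z) (hγζ : (γ * ζ / X) ^ 2 < C * Z)
    (hk : 0 ≤ k) (hkl : k ≤ l) (hl : l * Z ≤ 1) :
    (α * γ / X - l * (α * ζ / X) * (γ * ζ / X)) ^ 2 /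
        ((A - l * (α * ζ / X) ^ 2) * (C - l * (γ * ζ / X) ^ 2)) ≤
      (α * γ / X - k * (α * ζ / X) * (γ * ζ / X)) ^ 2 /
        ((A - k * (α * ζ / X) ^ 2) * (C - k * (γ * ζ / X) ^ 2)) := by
  have pos : ∀ {B q m : ℝ}, 0 < B → q ^ 2 < B * Z → 0 ≤ m → m * Z ≤ 1 → 0 < B - m * q ^ 2 := by
    intro B q m hB hq hm hmZ
    rcases hm.eq_or_lt with rfl | hm
    · simpa using hB
    · nlinarith [mul_lt_mul_of_pos_left hq hm, mul_le_mul_of_nonneg_left hmZ hB.le]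
  have hl0 : 0 ≤ l := hk.trans hkl
  have hkZ : k * Z ≤ 1 := (mul_le_mul_of_nonneg_right hkl hZ.le).trans hl
  have le_one : l * (ζ ^ 2 / X) ≤ 1 := by
    have : ζ ^ 2 / X ≤ Z := by rw [div_le_iff₀ hX]; linarith
    exact (mul_le_mul_of_nonneg_left this hl0).trans hl
  have hst : k * (ζ ^ 2 / X) ≤ l * (ζ ^ 2 / X) := by gcongr
  have den : ∀ B β m : ℝ, B - m * (β * ζ / X) ^ 2 = B - m * (ζ ^ 2 / X) * (β ^ 2 / X) := by
    intro B β m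
    field_simp
  have split : ∀ m : ℝ, (α * γ / X - m * (α * ζ / X) * (γ * ζ / X)) ^ 2 /
        ((A - m * (α * ζ / X) ^ 2) * (C - m * (γ * ζ / X) ^ 2)) =
      (α * γ / X) ^ 2 * ((1 - m * (ζ ^ 2 / X)) / (A - m * (ζ ^ 2 / X) * (α ^ 2 / X)) *
        ((1 - m * (ζ ^ 2 / X)) / (C - m * (ζ ^ 2 / X) * (γ ^ 2 / X)))) := by
    intro m
    have num : α * γ / X - m * (α * ζ / X) * (γ * ζ / X) =
        α * γ / X * (1 - m * (ζ ^ 2 / X)) := by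
      field_simp
    rw [num, den, den, div_mul_div_comm, ← mul_div_assoc]
    ring
  have pA := pos hA hαζ hl0 hl
  have pA' := pos hA hαζ hk hkZ
  have pC := pos hC hγζ hl0 hl
  have pC' := pos hC hγζ hk hkZ
  rw [den] at pA pA' pC pC'
  rw [split, split]
  refine mul_le_mul_of_nonneg_left (mul_le_mul ?_ ?_ ?_ ?_) (sq_nonneg _)
  · exact one_sub_div_sub_mul_anti ((div_le_iff₀ hX).2 hα) hst pA' pA
  · exact one_sub_div_sub_mul_anti ((div_le_iff₀ hX).2 hγ) hst pC' pC
  · exact div_nonneg (by linarith) pC.le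
  · exact div_nonneg (by linarith) pA'.le

/-- Theorem 2: under the conditions of part 1 and additionally
`a ⟂⟂ z' | z`, `c ⟂⟂ z' | z`, one has `ρ²_{ac|z} ≤ ρ²_{ac|z'} ≤ ρ²_{ac}`. -/
theorem stmt_2 [Fintype V] [DecidableEq V] [Nonempty V]
    (S : Matrix V V ℝ) (hsym : S.IsSymm) (hpd : S.PosDef)
    (a c z z' : V) (hac : a ≠ c) (haz : a ≠ z) (hcz : c ≠ z)
    (haz' : a ≠ z') (hcz' : c ≠ z') (hzz' : z ≠ z')
    (h : ∃ x : V, x ≠ z ∧ pcov S a c {x} = 0 ∧ pcov S a z {x} = 0 ∧ pcov S c z {x} = 0)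
    (h1 : pcov S a z' {z} = 0) (h2 : pcov S c z' {z} = 0) :
    rho2 S a c {z} ≤ rho2 S a c {z'} ∧ rho2 S a c {z'} ≤ rho2 S a c ∅ := by
  obtain ⟨x, -, hx1, hx2, hx3⟩ := h
  simp only [rho2, pcov_singleton, pcov_empty] at *
  have hX : 0 < S x x := hpd.diag_pos
  have hZ : 0 < S z z := hpd.diag_pos
  have hW : 0 < S z' z' := hpd.diag_pos
  have hr : S a c = S a x * S c x / S x x := by
    rw [hsym.apply c x] at hx1; rw [sub_eq_zero.1 hx1]; ring
  have hp : S a z = S a x * S z x / S x x := by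
    rw [hsym.apply z x] at hx2; rw [sub_eq_zero.1 hx2]; ring
  have hq : S c z = S c x * S z x / S x x := by
    rw [hsym.apply z x] at hx3; rw [sub_eq_zero.1 hx3]; ring
  have hp' := sub_eq_zero.1 h1
  have hq' := sub_eq_zero.1 h2
  have hζ : S z x ^ 2 ≤ S x x * S z z :=
    mul_comm (S z z) (S x x) ▸ sq_le_mul_diag_of_posDef hsym hpd z x
  have hzz := sq_le_mul_diag_of_posDef hsym hpd z z'
  have key := fun k l => sq_div_mul_anti_of_factor (k := k) (l := l) hX hZ
    (hpd.diag_pos (i := a)) (hpd.diag_pos (i := c))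
    (sq_le_mul_diag_of_posDef hsym hpd a x) (sq_le_mul_diag_of_posDef hsym hpd c x) hζ
    (hp ▸ sq_lt_mul_diag_of_posDef hsym hpd haz) (hq ▸ sq_lt_mul_diag_of_posDef hsym hpd hcz)
  simp only [← hr, ← hp, ← hq] at key
  rw [hsym.apply a z, hsym.apply c z, hsym.apply a z', hsym.apply c z', hp', hq']
  set k := S z z' ^ 2 / (S z z ^ 2 * S z' z') with hk
  have hk0 : 0 ≤ k := by positivity
  have hkZ : k * S z z ≤ 1 := by
    have : k * S z z = S z z' ^ 2 / (S z z * S z' z') := by rw [hk]; field_simp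
    rw [this, div_le_one (by positivity)]
    exact hzz
  have hkl : k ≤ (S z z)⁻¹ := by rwa [← one_div, le_div_iff₀ hZ]
  have hmul : ∀ b d : ℝ, b * (S z z)⁻¹ * S z z' * (S z' z')⁻¹ * (d * (S z z)⁻¹ * S z z') =
      k * b * d := by
    intro b d
    rw [hk]
    field_simp
  simp only [hmul]
  have low := key k (S z z)⁻¹ hk0 hkl (inv_mul_cancel₀ hZ.ne').le
  have high := key 0 k le_rfl hk0 hkZ
  constructor
  · convert low using 3 <;> ring
  · convert high using 3 <;> ring
end

section
/- With the notation of the context, suppose K > 0, M1·M2 ≥ 0, and α ∈ ℝ satisfies (α − K') − K·ρ_ad² > 0 and (α − K') − K·ρ_cd² > 0. Then: (1) if M1·M3(α) = 0 and M2·M3(α) = 0, the derivative of L at α is zero; (2) if M1·M3(α) > 0 or M2·M3(α) > 0, the derivative of L at α is strictly positive; (3) if M1·M3(α) < 0 or M2·M3(α) < 0, the derivative of L at α is strictly negative. -/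
/-- Correlation `ρ_uv = σ_uv / √(σ_uu σ_vv)`. -/
noncomputable def corrOf (suu svv suv : ℝ) : ℝ := suv / Real.sqrt (suu * svv)

/-- `M1 = σ_cd (σ_ad σ_cc − σ_ac σ_cd)`. -/
def Mone (saa scc sdd sac sad scd : ℝ) : ℝ := scd * (sad * scc - sac * scd)

/-- `M2 = σ_ad (σ_cd σ_aa − σ_ac σ_ad)`. -/
def Mtwo (saa scc sdd sac sad scd : ℝ) : ℝ := sad * (scd * saa - sac * sad)

/-- `M3(t) = (t − K') σ_ac σ_dd − K σ_ad σ_cd`. -/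
def Mthree (saa scc sdd sac sad scd K K' t : ℝ) : ℝ := (t - K') * sac * sdd - K * sad * scd

/-- The rational function `L`. -/
noncomputable def Lfun (saa scc sdd sac sad scd K K' : ℝ) : ℝ → ℝ := fun t =>
  ((t - K') * corrOf saa scc sac - K * corrOf saa sdd sad * corrOf scc sdd scd) ^ 2 /
    (((t - K') - K * corrOf saa sdd sad ^ 2) * ((t - K') - K * corrOf scc sdd scd ^ 2))

theorem eq_corrOf_mul_sqrt {u v : ℝ} (hu : 0 < u) (hv : 0 < v) (s : ℝ) :
    s = corrOf u v s * (√u * √v) := by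
  have := Real.sqrt_pos.2 hu
  have := Real.sqrt_pos.2 hv
  rw [corrOf, Real.sqrt_mul hu.le]
  field_simp

theorem hasDerivAt_sq_div_mul {a b c K K' t : ℝ} (hP : (t - K') - K * b ^ 2 ≠ 0)
    (hQ : (t - K') - K * c ^ 2 ≠ 0) :
    HasDerivAt (fun t => ((t - K') * a - K * b * c) ^ 2 /
        (((t - K') - K * b ^ 2) * ((t - K') - K * c ^ 2)))
      (K * (((t - K') - K * b ^ 2) * (c * (b - a * c) * ((t - K') * a - K * b * c)) +
          ((t - K') - K * c ^ 2) * (b * (c - a * b) * ((t - K') * a - K * b * c))) /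
        (((t - K') - K * b ^ 2) * ((t - K') - K * c ^ 2)) ^ 2) t := by
  have h : HasDerivAt (fun t => t - K') 1 t := (hasDerivAt_id t).sub_const K'
  refine ((((h.mul_const a).sub_const (K * b * c)).pow 2).div
    ((h.sub_const (K * b ^ 2)).mul (h.sub_const (K * c ^ 2)))
    (mul_ne_zero hP hQ)).congr_deriv ?_
  simp only [Pi.mul_apply, Pi.pow_apply]
  congr 1
  push_cast
  ring

theorem weighted_sum_pos {p q x y : ℝ} (hp : 0 < p) (hq : 0 < q) (hxy : 0 ≤ x * y)
    (h : 0 < x ∨ 0 < y) : 0 < p * x + q * y := by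
  rcases h with h | h
  · have := nonneg_of_mul_nonneg_right hxy h
    positivity
  · have := nonneg_of_mul_nonneg_left hxy h
    positivity

/-- Lemma 2: sign of the derivative of `L` at `α`. -/
theorem stmt_11 (saa scc sdd sac sad scd K K' α : ℝ)
    (haa : 0 < saa) (hcc : 0 < scc) (hdd : 0 < sdd)
    (hK : 0 < K)
    (hM12 : 0 ≤ Mone saa scc sdd sac sad scd * Mtwo saa scc sdd sac sad scd)
    (had : 0 < (α - K') - K * corrOf saa sdd sad ^ 2)
    (hcd : 0 < (α - K') - K * corrOf scc sdd scd ^ 2) :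
    ((Mone saa scc sdd sac sad scd * Mthree saa scc sdd sac sad scd K K' α = 0 ∧
      Mtwo saa scc sdd sac sad scd * Mthree saa scc sdd sac sad scd K K' α = 0) →
        deriv (Lfun saa scc sdd sac sad scd K K') α = 0) ∧
    ((0 < Mone saa scc sdd sac sad scd * Mthree saa scc sdd sac sad scd K K' α ∨
      0 < Mtwo saa scc sdd sac sad scd * Mthree saa scc sdd sac sad scd K K' α) →
        0 < deriv (Lfun saa scc sdd sac sad scd K K') α) ∧
    ((Mone saa scc sdd sac sad scd * Mthree saa scc sdd sac sad scd K K' α < 0 ∨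
      Mtwo saa scc sdd sac sad scd * Mthree saa scc sdd sac sad scd K K' α < 0) →
        deriv (Lfun saa scc sdd sac sad scd K K') α < 0) := by
  have hp := Real.sqrt_pos.2 haa
  have hq := Real.sqrt_pos.2 hcc
  have hr := Real.sqrt_pos.2 hdd
  have eaa := Real.sq_sqrt haa.le
  have ecc := Real.sq_sqrt hcc.le
  have edd := Real.sq_sqrt hdd.le
  have eac := eq_corrOf_mul_sqrt haa hcc sac
  have ead := eq_corrOf_mul_sqrt haa hdd sad
  have ecd := eq_corrOf_mul_sqrt hcc hdd scd
  have hL : HasDerivAt (Lfun saa scc sdd sac sad scd K K') _ α :=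
    hasDerivAt_sq_div_mul (a := corrOf saa scc sac) had.ne' hcd.ne'
  rw [hL.deriv]
  clear hL
  generalize corrOf saa scc sac = a at *
  generalize corrOf saa sdd sad = b at *
  generalize corrOf scc sdd scd = c at *
  generalize √saa = p at *
  generalize √scc = q at *
  generalize √sdd = r at *
  subst eaa ecc edd eac ead ecd
  have e1 : Mone (p ^ 2) (q ^ 2) (r ^ 2) (a * (p * q)) (b * (p * r)) (c * (q * r)) =
      p * q ^ 3 * r ^ 2 * (c * (b - a * c)) := by unfold Mone; ring
  have e2 : Mtwo (p ^ 2) (q ^ 2) (r ^ 2) (a * (p * q)) (b * (p * r)) (c * (q * r)) =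
      p ^ 3 * q * r ^ 2 * (b * (c - a * b)) := by unfold Mtwo; ring
  have e3 : Mthree (p ^ 2) (q ^ 2) (r ^ 2) (a * (p * q)) (b * (p * r)) (c * (q * r)) K K' α =
      p * q * r ^ 2 * ((α - K') * a - K * b * c) := by unfold Mthree; ring
  rw [e1, e2, mul_mul_mul_comm, mul_nonneg_iff_of_pos_left (by positivity)] at hM12
  rw [e1, e2, e3, mul_mul_mul_comm, mul_mul_mul_comm (p ^ 3 * q * r ^ 2)]
  generalize c * (b - a * c) = m₁ at *
  generalize b * (c - a * b) = m₂ at *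
  generalize (α - K') * a - K * b * c = n at *
  have hw₁ : 0 < p * q ^ 3 * r ^ 2 * (p * q * r ^ 2) := by positivity
  have hw₂ : 0 < p ^ 3 * q * r ^ 2 * (p * q * r ^ 2) := by positivity
  have hmn : 0 ≤ m₁ * n * (m₂ * n) := by
    rw [mul_mul_mul_comm]
    exact mul_nonneg hM12 (mul_self_nonneg n)
  refine ⟨fun ⟨h₁, h₂⟩ => ?_, fun h => ?_, fun h => ?_⟩
  · rw [(mul_eq_zero.1 h₁).resolve_left hw₁.ne', (mul_eq_zero.1 h₂).resolve_left hw₂.ne']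
    simp
  · rw [mul_pos_iff_of_pos_left hw₁, mul_pos_iff_of_pos_left hw₂] at h
    have := weighted_sum_pos had hcd hmn h
    positivity
  · simp only [← neg_pos (a := _ * _), ← mul_neg (_ * _)] at h
    rw [mul_pos_iff_of_pos_left hw₁, mul_pos_iff_of_pos_left hw₂] at h
    have := weighted_sum_pos had hcd (by rwa [neg_mul_neg]) h
    exact div_neg_of_neg_of_pos (mul_neg_of_pos_of_neg hK (by linarith)) (by positivity)
end
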